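/- Let E0 > 0 and ω > 0, and consider the SFA trajectory with x0 = 0, i.e. x(t) = p0·t + (E0/ω²)·(cos(ωt) − 1). If 0 < p0 ≤ 2E0/(πω), then the electron returns to the core within half a laser cycle: there exists t ∈ (0, π/ω] with x(t) = 0. -/

import Mathlib

open Real

/-- For the SFA trajectory `x(t) = p0·t + (E0/ω²)(cos(ωt) − 1)` with `x0 = 0`:
if `0 < p0 ≤ 2E0/(πω)`, the electron returns to the core within half a laser cycle. -/
theorem sfa_return_of_small_drift (E0 ω p0 : ℝ) (hE0 : 0 < E0) (hω : 0 < ω)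
    (hp0 : 0 < p0) (hp0' : p0 ≤ 2 * E0 / (Real.pi * ω)) :
    ∃ t ∈ Set.Ioc (0 : ℝ) (Real.pi / ω),
      p0 * t + (E0 / ω ^ 2) * (Real.cos (ω * t) - 1) = 0 := by
  have hp : p0 * (π * ω) ≤ 2 * E0 := (le_div_iff₀ (by positivity)).1 hp0'
  have hstart : 0 < p0 / E0 := by positivity
  have hle : p0 / E0 ≤ π / ω := by
    rw [div_le_div_iff₀ hE0 hω]
    have hpω : 0 < p0 * ω := mul_pos hp0 hω
    nlinarith [pi_gt_three]
  have hcont : ContinuousOn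
      (fun t : ℝ => p0 * t + (E0 / ω ^ 2) * (Real.cos (ω * t) - 1))
      (Set.Icc (p0 / E0) (π / ω)) := by fun_prop
  have hpos : 0 ≤ p0 * (p0 / E0) + (E0 / ω ^ 2) * (Real.cos (ω * (p0 / E0)) - 1) := by
    have hcos : -((ω * (p0 / E0)) ^ 2 / 2) ≤ Real.cos (ω * (p0 / E0)) - 1 := by
      linarith [one_sub_sq_div_two_le_cos (x := ω * (p0 / E0))]
    calc (0 : ℝ) ≤ p0 ^ 2 / (2 * E0) := by positivity
      _ = p0 * (p0 / E0) + (E0 / ω ^ 2) * -((ω * (p0 / E0)) ^ 2 / 2) := by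
        field_simp
        ring
      _ ≤ _ := by gcongr
  have hneg : p0 * (π / ω) + (E0 / ω ^ 2) * (Real.cos (ω * (π / ω)) - 1) ≤ 0 := by
    rw [mul_div_cancel₀ π hω.ne', cos_pi]
    have heq : p0 * (π / ω) + (E0 / ω ^ 2) * (-1 - 1) =
        (p0 * (π * ω) - 2 * E0) / ω ^ 2 := by
      field_simp
      ring
    rw [heq]
    exact div_nonpos_of_nonpos_of_nonneg (by linarith) (by positivity)
  obtain ⟨t, ht, hzero⟩ := intermediate_value_Icc' hle hcont ⟨hneg, hpos⟩
  exact ⟨t, ⟨hstart.trans_le ht.1, ht.2⟩, hzero⟩
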